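/- arXiv:2505.22075 — 2 statements merged into one kernel-verified Lean document; each statement's English description precedes it below -/
import Mathlib

section
/- Let A be a real L×m matrix, b ∈ ℝ^L, C a real k×m matrix, d ∈ ℝ^k, and ξ̂ ∈ ℝ^m. Suppose θ ∈ ℝ^L and γ ∈ ℝ^k satisfy θ ≥ 0 and γ ≥ 0 componentwise, λ ≥ 0, and ‖Aᵀθ + Cᵀγ‖₂ ≤ λ. Then for every ξ ∈ ℝ^m with Cξ ≤ d and Aξ ≤ b (componentwise), one has 1 − λ‖ξ − ξ̂‖₂ ≤ 1 + ⟨θ, b − Aξ̂⟩ + ⟨γ, d − Cξ̂⟩. -/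
open Matrix

/-- The Euclidean (2-)norm of a vector in `ℝ^m`. -/
noncomputable def euclNorm {m : ℕ} (x : Fin m → ℝ) : ℝ :=
  Real.sqrt (∑ i, (x i) ^ 2)

theorem neg_dotProduct_le_euclNorm_mul {m : ℕ} (u v : Fin m → ℝ) :
    -(u ⬝ᵥ v) ≤ euclNorm u * euclNorm v := by
  simpa [dotProduct, euclNorm] using
    Real.sum_mul_le_sqrt_mul_sqrt Finset.univ (fun i => -u i) v

theorem transpose_mulVec_dotProduct_sub_le {m n : ℕ} (M : Matrix (Fin n) (Fin m) ℝ)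
    (c w : Fin n → ℝ) (hw : ∀ i, 0 ≤ w i) (x y : Fin m → ℝ) (hx : ∀ i, M.mulVec x i ≤ c i) :
    M.transpose.mulVec w ⬝ᵥ (x - y) ≤ w ⬝ᵥ (c - M.mulVec y) := by
  rw [mulVec_transpose, ← dotProduct_mulVec, mulVec_sub]
  exact Finset.sum_le_sum fun i _ =>
    mul_le_mul_of_nonneg_left (sub_le_sub_right (hx i) _) (hw i)

/-- Pointwise weak-duality bound for the best-case (safe) probability
reformulation: if `θ ≥ 0`, `γ ≥ 0`, `λ ≥ 0` and `‖Aᵀθ + Cᵀγ‖₂ ≤ λ`, then for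
every `ξ` with `Cξ ≤ d` and `Aξ ≤ b` one has
`1 - λ‖ξ - ξ̂‖₂ ≤ 1 + ⟨θ, b - Aξ̂⟩ + ⟨γ, d - Cξ̂⟩`. -/
theorem best_case_pointwise_duality_bound {m k L : ℕ}
    (A : Matrix (Fin L) (Fin m) ℝ) (b : Fin L → ℝ)
    (C : Matrix (Fin k) (Fin m) ℝ) (d : Fin k → ℝ) (ξhat : Fin m → ℝ)
    (θ : Fin L → ℝ) (hθ : ∀ l, 0 ≤ θ l)
    (γ : Fin k → ℝ) (hγ : ∀ j, 0 ≤ γ j) (lam : ℝ) (hlam : 0 ≤ lam)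
    (hdual : euclNorm (A.transpose.mulVec θ + C.transpose.mulVec γ) ≤ lam) :
    ∀ ξ : Fin m → ℝ, (∀ j, C.mulVec ξ j ≤ d j) → (∀ l, A.mulVec ξ l ≤ b l) →
      1 - lam * euclNorm (ξ - ξhat) ≤
        1 + θ ⬝ᵥ (b - A.mulVec ξhat) + γ ⬝ᵥ (d - C.mulVec ξhat) := by
  intro ξ hC hA
  have hAθ := transpose_mulVec_dotProduct_sub_le A b θ hθ ξ ξhat hA
  have hCγ := transpose_mulVec_dotProduct_sub_le C d γ hγ ξ ξhat hC
  have hcs := neg_dotProduct_le_euclNorm_mul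
    (A.transpose.mulVec θ + C.transpose.mulVec γ) (ξ - ξhat)
  have hnorm : 0 ≤ euclNorm (ξ - ξhat) := Real.sqrt_nonneg _
  have hmul := mul_le_mul_of_nonneg_right hdual hnorm
  rw [add_dotProduct] at hcs
  linarith
end

section
/- Let S = {ξ ∈ ℝ^m : Cξ ≤ d} and Ŝ = {ξ ∈ ℝ^m : Aξ < b} with A a real L×m matrix whose rows are a₁,…,a_L and b ∈ ℝ^L. Let ξ̂₁,…,ξ̂_N ∈ S be samples, and suppose λ ≥ 0, s₁,…,s_N ≥ 0, and for each i ≤ N and l ≤ L, scalars θ_{il} ≥ 0 and vectors γ_{il} ∈ ℝ^k with γ_{il} ≥ 0 satisfy: (i) 1 − θ_{il}(b_l − ⟨a_l, ξ̂ᵢ⟩) + ⟨γ_{il}, d − Cξ̂ᵢ⟩ ≤ sᵢ and (ii) ‖θ_{il} a_l − Cᵀγ_{il}‖₂ ≤ λ. Then for every ε ≥ 0 and every choice of points ξ₁,…,ξ_N ∈ S with (1/N)Σᵢ ‖ξᵢ − ξ̂ᵢ‖₂ ≤ ε, one has (1/N)·#{i : ξᵢ ∉ Ŝ} ≤ λε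 + (1/N)Σᵢ sᵢ. -/
open Matrix

theorem euclNorm_nonneg {m : ℕ} (x : Fin m → ℝ) : 0 ≤ euclNorm x :=
  Real.sqrt_nonneg _

theorem dotProduct_le_euclNorm_mul {m : ℕ} (x y : Fin m → ℝ) :
    x ⬝ᵥ y ≤ euclNorm x * euclNorm y :=
  Real.sum_mul_le_sqrt_mul_sqrt Finset.univ x y

/-- Weak duality at a single point: if `y` violates the constraint `⟨a, y⟩ < β`, then moving
`x` to `y` costs enough that `lam * ‖y - x‖ + s` is at least one. -/
theorem one_le_of_dual_feasible {m k : ℕ} (C : Matrix (Fin k) (Fin m) ℝ) (d : Fin k → ℝ)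
    (a x y : Fin m → ℝ) (β lam s θ : ℝ) (γ : Fin k → ℝ) (hθ : 0 ≤ θ) (hγ : ∀ j, 0 ≤ γ j)
    (hcon : 1 - θ * (β - a ⬝ᵥ x) + γ ⬝ᵥ (d - C.mulVec x) ≤ s)
    (hdual : euclNorm (θ • a - C.transpose.mulVec γ) ≤ lam)
    (hy : ∀ j, C.mulVec y j ≤ d j) (hβ : β ≤ a ⬝ᵥ y) :
    1 ≤ lam * euclNorm (y - x) + s := by
  have hslack : 0 ≤ γ ⬝ᵥ (d - C.mulVec y) :=
    Finset.sum_nonneg fun j _ => mul_nonneg (hγ j) (sub_nonneg.2 (hy j))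
  have hcs := dotProduct_le_euclNorm_mul (θ • a - C.transpose.mulVec γ) (y - x)
  have hle := mul_le_mul_of_nonneg_right hdual (euclNorm_nonneg (y - x))
  have hθβ := mul_le_mul_of_nonneg_left hβ hθ
  simp only [mulVec_transpose, sub_dotProduct, dotProduct_sub, smul_dotProduct, smul_eq_mul,
    ← dotProduct_mulVec] at hcs hslack hcon hle
  linarith

open Classical in
/-- Weak-duality upper bound of the finite-program reformulation of the
worst-case probability of being unsafe: if the dual feasibility conditions
hold, then for every Wasserstein-`ε` transport `ξ` of the samples `ξ̂`
supported on `S = {ξ | Cξ ≤ d}`, the fraction of transported points lying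
outside the open safety polytope `Ŝ = {ξ | Aξ < b}` is at most
`λε + (1/N) ∑ᵢ sᵢ`. -/
theorem worst_case_finite_program_upper_bound {m k L N : ℕ}
    (C : Matrix (Fin k) (Fin m) ℝ) (d : Fin k → ℝ)
    (A : Matrix (Fin L) (Fin m) ℝ) (b : Fin L → ℝ)
    (ξhat : Fin N → Fin m → ℝ) (hξhat : ∀ i j, C.mulVec (ξhat i) j ≤ d j)
    (lam : ℝ) (hlam : 0 ≤ lam) (s : Fin N → ℝ) (hs : ∀ i, 0 ≤ s i)
    (θ : Fin N → Fin L → ℝ) (hθ : ∀ i l, 0 ≤ θ i l)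
    (γ : Fin N → Fin L → Fin k → ℝ) (hγ : ∀ i l j, 0 ≤ γ i l j)
    (hcon : ∀ i l,
      1 - θ i l * (b l - A l ⬝ᵥ ξhat i) + γ i l ⬝ᵥ (d - C.mulVec (ξhat i)) ≤ s i)
    (hdual : ∀ i l, euclNorm (θ i l • A l - C.transpose.mulVec (γ i l)) ≤ lam) :
    ∀ ε : ℝ, 0 ≤ ε → ∀ ξ : Fin N → Fin m → ℝ,
      (∀ i j, C.mulVec (ξ i) j ≤ d j) →
      (1 / (N : ℝ)) * ∑ i, euclNorm (ξ i - ξhat i) ≤ ε →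
      (1 / (N : ℝ)) *
          ((Finset.univ.filter (fun i : Fin N => ¬ ∀ l, A.mulVec (ξ i) l < b l)).card : ℝ) ≤
        lam * ε + (1 / (N : ℝ)) * ∑ i, s i := by
  intro ε _ ξ hξ hε
  have hpoint : ∀ i, (if ¬ ∀ l, A.mulVec (ξ i) l < b l then (1 : ℝ) else 0) ≤
      lam * euclNorm (ξ i - ξhat i) + s i := by
    intro i
    split_ifs with h
    · exact add_nonneg (mul_nonneg hlam (euclNorm_nonneg _)) (hs i)
    · push Not at h
      obtain ⟨l, hl⟩ := h
      exact one_le_of_dual_feasible C d (A l) (ξhat i) (ξ i) (b l) lam (s i) (θ i l) (γ i l)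
        (hθ i l) (hγ i l) (hcon i l) (hdual i l) (hξ i) hl
  have hsum := Finset.sum_le_sum fun i (_ : i ∈ Finset.univ) => hpoint i
  rw [Finset.sum_boole, Finset.sum_add_distrib, ← Finset.mul_sum] at hsum
  calc _ ≤ (1 / (N : ℝ)) * (lam * ∑ i, euclNorm (ξ i - ξhat i) + ∑ i, s i) :=
        mul_le_mul_of_nonneg_left hsum (by positivity)
    _ = lam * ((1 / (N : ℝ)) * ∑ i, euclNorm (ξ i - ξhat i)) + (1 / (N : ℝ)) * ∑ i, s i := by
        ring
    _ ≤ _ := by gcongr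
end
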